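/- arXiv:2501.16594 — 4 statements merged into one kernel-verified Lean document; each statement's English description precedes it below -/
import Mathlib

section
/- Let H be a real inner product space, V ⊆ H a subspace, ℓ a second inner product on V, and P : H → V a linear map satisfying ℓ(φ, P g) = ⟨φ, g⟩ for all φ ∈ V and all g ∈ H. Assume there is a constant C ≥ 1 with ‖φ‖² ≤ ℓ(φ, φ) ≤ C‖φ‖² for all φ ∈ V. Then for every g ∈ H one has the two-sided bound ‖g − P g‖² ≤ ⟨g − P g, g⟩ ≤ ‖g − P g‖² + (C − 1)‖P g‖²; in particular the form s(g, g') := ⟨g − P g, g'⟩ is positive semidefinite, i.e. s(g, g) ≥ 0 for all g ∈ H. -/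
open scoped RealInnerProductSpace

/-- Let `H` be a real inner product space, `V ⊆ H` a subspace, `ℓ` a second
inner product on `V`, and `P : H → V` a linear map satisfying `ℓ(φ, P g) = ⟨φ, g⟩` for all
`φ ∈ V`, `g ∈ H`. Assume `‖φ‖² ≤ ℓ(φ, φ) ≤ C‖φ‖²` on `V` with `C ≥ 1`. Then
`‖g − P g‖² ≤ ⟨g − P g, g⟩ ≤ ‖g − P g‖² + (C − 1)‖P g‖²`; in particular the form
`s(g, g') := ⟨g − P g, g'⟩` is positive semidefinite. -/
theorem projected_gradient_form_two_sided_bound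
    {H : Type*} [NormedAddCommGroup H] [InnerProductSpace ℝ H]
    (V : Submodule ℝ H)
    (ℓ : V →ₗ[ℝ] V →ₗ[ℝ] ℝ)
    (hℓ_symm : ∀ φ ψ : V, ℓ φ ψ = ℓ ψ φ)
    (hℓ_posdef : ∀ φ : V, φ ≠ 0 → 0 < ℓ φ φ)
    (P : H →ₗ[ℝ] V)
    (hP : ∀ (φ : V) (g : H), ℓ φ (P g) = ⟪(φ : H), g⟫)
    (C : ℝ) (hC : 1 ≤ C)
    (hlow : ∀ φ : V, ‖(φ : H)‖ ^ 2 ≤ ℓ φ φ)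
    (hupp : ∀ φ : V, ℓ φ φ ≤ C * ‖(φ : H)‖ ^ 2)
    (s : H → H → ℝ)
    (hs : ∀ g g' : H, s g g' = ⟪g - (P g : H), g'⟫) :
    (∀ g : H,
      ‖g - (P g : H)‖ ^ 2 ≤ ⟪g - (P g : H), g⟫ ∧
      ⟪g - (P g : H), g⟫ ≤ ‖g - (P g : H)‖ ^ 2 + (C - 1) * ‖(P g : H)‖ ^ 2) ∧
    (∀ g : H, 0 ≤ s g g) := by
  have key : ∀ g : H,
      ‖g - (P g : H)‖ ^ 2 ≤ ⟪g - (P g : H), g⟫ ∧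
      ⟪g - (P g : H), g⟫ ≤ ‖g - (P g : H)‖ ^ 2 + (C - 1) * ‖(P g : H)‖ ^ 2 := by
    intro g
    have hl := hlow (P g)
    have hu := hupp (P g)
    rw [hP (P g) g] at hl hu
    rw [norm_sub_sq_real, inner_sub_left, real_inner_self_eq_norm_sq,
      real_inner_comm (P g : H) g]
    constructor <;> linarith
  refine ⟨key, fun g => ?_⟩
  rw [hs]
  exact (sq_nonneg _).trans (key g).1
end

section
/- Let H be a real inner product space, V ⊆ H a subspace, ℓ a second inner product on V, and P : H → V a linear map satisfying ℓ(φ, P g) = ⟨φ, g⟩ for all φ ∈ V and all g ∈ H. Assume ‖φ‖² ≤ ℓ(φ, φ) for all φ ∈ V. Then the symmetric bilinear form s(g, g') := ⟨g − P g, g'⟩ is a semi-inner product on H and satisfies the Cauchy–Schwarz inequality |s(g, g')| ≤ s(g, g)^{1/2} · s(g', g')^{1/2} for all g, g' ∈ H. -/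
open scoped RealInnerProductSpace

/-- Let `H` be a real inner product space, `V ⊆ H` a subspace, `ℓ` a second
inner product on `V`, and `P : H → V` a linear map satisfying `ℓ(φ, P g) = ⟨φ, g⟩` for all
`φ ∈ V`, `g ∈ H`. Assume `‖φ‖² ≤ ℓ(φ, φ)` on `V`. Then `s(g, g') := ⟨g − P g, g'⟩` is a
semi-inner product on `H` (symmetric and positive semidefinite) and satisfies the
Cauchy–Schwarz inequality `|s(g, g')| ≤ s(g, g)^{1/2} · s(g', g')^{1/2}`. -/
theorem projected_gradient_form_cauchy_schwarz
    {H : Type*} [NormedAddCommGroup H] [InnerProductSpace ℝ H]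
    (V : Submodule ℝ H)
    (ℓ : V →ₗ[ℝ] V →ₗ[ℝ] ℝ)
    (hℓ_symm : ∀ φ ψ : V, ℓ φ ψ = ℓ ψ φ)
    (hℓ_posdef : ∀ φ : V, φ ≠ 0 → 0 < ℓ φ φ)
    (P : H →ₗ[ℝ] V)
    (hP : ∀ (φ : V) (g : H), ℓ φ (P g) = ⟪(φ : H), g⟫)
    (hlow : ∀ φ : V, ‖(φ : H)‖ ^ 2 ≤ ℓ φ φ)
    (s : H → H → ℝ)
    (hs : ∀ g g' : H, s g g' = ⟪g - (P g : H), g'⟫) :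
    (∀ g g' : H, s g g' = s g' g) ∧
    (∀ g : H, 0 ≤ s g g) ∧
    (∀ g g' : H, |s g g'| ≤ Real.sqrt (s g g) * Real.sqrt (s g' g')) := by
  have hPP : ∀ g g' : H, ⟪(P g : H), g'⟫ = ℓ (P g) (P g') := fun g g' => (hP (P g) g').symm
  have symm : ∀ g g' : H, s g g' = s g' g := fun g g' => by
    rw [hs, hs, inner_sub_left, inner_sub_left, hPP, hPP, hℓ_symm (P g), real_inner_comm]
  have nonneg : ∀ g : H, 0 ≤ s g g := fun g => by
    have hsq := norm_sub_sq_real g (P g : H)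
    have hle := hlow (P g)
    rw [← hPP] at hle
    rw [real_inner_comm] at hsq
    rw [hs, inner_sub_left, real_inner_self_eq_norm_sq]
    nlinarith [sq_nonneg ‖g - (P g : H)‖]
  refine ⟨symm, nonneg, fun g g' => ?_⟩
  let B : LinearMap.BilinForm ℝ H := innerₗ H ∘ₗ (LinearMap.id - V.subtype ∘ₗ P)
  have hB : ∀ x y : H, B x y = s x y := fun x y => by simp [B, hs, inner_sub_left]
  have hcs := B.apply_sq_le_of_symm (fun x => by simpa only [hB] using nonneg x)
    ⟨fun x y => by simpa only [hB, RingHom.id_apply] using symm x y⟩ g g'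
  simp only [hB] at hcs
  rw [← Real.sqrt_mul (nonneg g)]
  exact Real.abs_le_sqrt hcs
end

section
/- Let H be a real inner product space, V ⊆ H a subspace, ℓ a second inner product on V, and P : H → V a linear map satisfying ℓ(φ, P g) = ⟨φ, g⟩ for all φ ∈ V and all g ∈ H. Assume there is c > 0 with c‖φ‖² ≤ ℓ(φ, φ) for all φ ∈ V. Then the stabilization form s(g, g') := ⟨g − P g, g'⟩ is continuous: |s(g, g')| ≤ (1 + c⁻¹)‖g‖·‖g'‖ for all g, g' ∈ H. -/
open scoped RealInnerProductSpace

/-- Let `H` be a real inner product space, `V ⊆ H` a subspace, `ℓ` a second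
inner product on `V`, and `P : H → V` a linear map satisfying `ℓ(φ, P g) = ⟨φ, g⟩` for all
`φ ∈ V`, `g ∈ H`. Assume `c‖φ‖² ≤ ℓ(φ, φ)` on `V` with `c > 0`. Then the stabilization form
`s(g, g') := ⟨g − P g, g'⟩` is continuous: `|s(g, g')| ≤ (1 + c⁻¹)‖g‖·‖g'‖`. -/
theorem projected_gradient_form_continuous
    {H : Type*} [NormedAddCommGroup H] [InnerProductSpace ℝ H]
    (V : Submodule ℝ H)
    (ℓ : V →ₗ[ℝ] V →ₗ[ℝ] ℝ)
    (hℓ_symm : ∀ φ ψ : V, ℓ φ ψ = ℓ ψ φ)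
    (hℓ_posdef : ∀ φ : V, φ ≠ 0 → 0 < ℓ φ φ)
    (P : H →ₗ[ℝ] V)
    (hP : ∀ (φ : V) (g : H), ℓ φ (P g) = ⟪(φ : H), g⟫)
    (c : ℝ) (hc : 0 < c)
    (hlow : ∀ φ : V, c * ‖(φ : H)‖ ^ 2 ≤ ℓ φ φ)
    (s : H → H → ℝ)
    (hs : ∀ g g' : H, s g g' = ⟪g - (P g : H), g'⟫) :
    ∀ g g' : H, |s g g'| ≤ (1 + c⁻¹) * ‖g‖ * ‖g'‖ := by
  intro g g'
  have hPg : ‖(P g : H)‖ ≤ c⁻¹ * ‖g‖ := by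
    have henergy : c * ‖(P g : H)‖ ^ 2 ≤ ‖(P g : H)‖ * ‖g‖ :=
      ((hlow (P g)).trans_eq (hP (P g) g)).trans (real_inner_le_norm _ _)
    rw [le_inv_mul_iff₀ hc]
    rcases (norm_nonneg (P g : H)).eq_or_lt with h | h
    · rw [← h, mul_zero]
      exact norm_nonneg g
    · refine le_of_mul_le_mul_left ?_ h
      linarith
  rw [hs]
  calc |⟪g - (P g : H), g'⟫| ≤ ‖g - (P g : H)‖ * ‖g'‖ := abs_real_inner_le_norm _ _
    _ ≤ (1 + c⁻¹) * ‖g‖ * ‖g'‖ := by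
      gcongr
      linarith [norm_sub_le g (P g : H)]
end

section
/- Let (X, ‖·‖) be a real normed vector space, V ⊆ X a subspace, and let a, s : X × X → ℝ be bilinear forms such that: (i) |a(x, y)| ≤ M‖x‖‖y‖ for all x, y ∈ X; (ii) s is symmetric, s(x, x) ≥ 0 for all x ∈ X, s satisfies |s(x, y)| ≤ s(x, x)^{1/2} s(y, y)^{1/2}, and s(x, x) ≤ C‖x‖² for all x ∈ X; (iii) there is α > 0 with a(v, v) + s(v, v) ≥ α‖v‖² for all v ∈ V. Suppose u ∈ X and u_h ∈ V satisfy the Galerkin relation a(u − u_h, v) = s(u_h, v) for all v ∈ V. Then for every χ ∈ V one has ‖χ − u_h‖ ≤ α⁻¹ ( (M + C)‖u − χ‖ + C^{1/2} · s(u, u)^{1/2} ). -/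
/-- Abstract Strang-type quasi-optimality estimate: if `a` is a bounded
bilinear form, `s` a symmetric positive semidefinite bilinear form satisfying
Cauchy–Schwarz and `s(x,x) ≤ C‖x‖²`, `a + s` is coercive on the subspace `V` with constant
`α > 0`, and `u, u_h` satisfy the Galerkin relation `a(u − u_h, v) = s(u_h, v)` for all
`v ∈ V`, then for every `χ ∈ V`,
`‖χ − u_h‖ ≤ α⁻¹ ((M + C)‖u − χ‖ + C^{1/2} s(u,u)^{1/2})`. -/
theorem strang_quasi_optimality
    {X : Type*} [NormedAddCommGroup X] [NormedSpace ℝ X]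
    (V : Submodule ℝ X)
    (a s : X →ₗ[ℝ] X →ₗ[ℝ] ℝ)
    (M C α : ℝ)
    (ha_bdd : ∀ x y : X, |a x y| ≤ M * ‖x‖ * ‖y‖)
    (hs_symm : ∀ x y : X, s x y = s y x)
    (hs_nonneg : ∀ x : X, 0 ≤ s x x)
    (hs_cs : ∀ x y : X, |s x y| ≤ Real.sqrt (s x x) * Real.sqrt (s y y))
    (hs_bdd : ∀ x : X, s x x ≤ C * ‖x‖ ^ 2)
    (hα : 0 < α)
    (hcoer : ∀ v ∈ V, α * ‖v‖ ^ 2 ≤ a v v + s v v)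
    (u uh : X) (huh : uh ∈ V)
    (hGalerkin : ∀ v ∈ V, a (u - uh) v = s uh v) :
    ∀ χ ∈ V, ‖χ - uh‖ ≤ α⁻¹ * ((M + C) * ‖u - χ‖ + Real.sqrt C * Real.sqrt (s u u)) := by
  intro χ hχ
  have hs_sqrt (x : X) : √(s x x) ≤ √C * ‖x‖ := by
    simpa [Real.sqrt_mul' C (sq_nonneg ‖x‖), Real.sqrt_sq (norm_nonneg x)] using
      Real.sqrt_le_sqrt (hs_bdd x)
  rw [← div_eq_inv_mul, le_div_iff₀ hα]
  rcases eq_or_ne (χ - uh) 0 with he | he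
  · rw [he, norm_zero, zero_mul]
    have hM : 0 ≤ M * ‖u - χ‖ * ‖u - χ‖ := (abs_nonneg _).trans (ha_bdd (u - χ) (u - χ))
    have hC : 0 ≤ C * ‖u - χ‖ ^ 2 := (hs_nonneg _).trans (hs_bdd (u - χ))
    have hMC : 0 ≤ (M + C) * ‖u - χ‖ := by
      rcases (norm_nonneg (u - χ)).eq_or_lt with h | h
      · simp [← h]
      · exact nonneg_of_mul_nonneg_left (by linarith) h
    positivity
  · have hn : 0 < ‖χ - uh‖ := norm_pos_iff.mpr he
    have hC : 0 ≤ C :=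
      nonneg_of_mul_nonneg_left ((hs_nonneg _).trans (hs_bdd (χ - uh))) (pow_pos hn 2)
    have hsplit : a (χ - uh) (χ - uh) + s (χ - uh) (χ - uh) =
        -a (u - χ) (χ - uh) - s (u - χ) (χ - uh) + s u (χ - uh) := by
      have hG := hGalerkin (χ - uh) (V.sub_mem hχ huh)
      simp only [map_sub, LinearMap.sub_apply] at hG ⊢
      linarith
    have h_a := (neg_le_abs _).trans (ha_bdd (u - χ) (χ - uh))
    have h_s : -s (u - χ) (χ - uh) ≤ C * ‖u - χ‖ * ‖χ - uh‖ :=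
      calc -s (u - χ) (χ - uh)
          ≤ √(s (u - χ) (u - χ)) * √(s (χ - uh) (χ - uh)) := (neg_le_abs _).trans (hs_cs _ _)
        _ ≤ (√C * ‖u - χ‖) * (√C * ‖χ - uh‖) := by gcongr <;> exact hs_sqrt _
        _ = (√C * √C) * ‖u - χ‖ * ‖χ - uh‖ := by ring
        _ = C * ‖u - χ‖ * ‖χ - uh‖ := by rw [Real.mul_self_sqrt hC]
    have h_u : s u (χ - uh) ≤ √(s u u) * (√C * ‖χ - uh‖) :=
      (le_abs_self _).trans <| (hs_cs _ _).trans <| by gcongr; exact hs_sqrt _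
    have hc := hcoer (χ - uh) (V.sub_mem hχ huh)
    refine le_of_mul_le_mul_right ?_ hn
    linarith
end
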